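/- arXiv:2601.07286 — 2 statements merged into one kernel-verified Lean document; each statement's English description precedes it below -/
import Mathlib

section
/- Let A, B be n×n Hermitian matrices, H = A + B, Q₃ = A³ + 3A²B + 3AB² + B³. Then the eigenvalue vector of H³ is weakly majorized by the singular value vector of Q₃: for every r = 1,...,n, the sum of the r largest eigenvalues of H³ is at most the sum of the r largest singular values of Q₃. -/
open Matrix BigOperators
open scoped ComplexOrder

/-- `descSort f` lists the values of `f` in nonincreasing order:
`descSort f j` is the `j`-th largest value of `f`. -/
noncomputable def descSort {n : ℕ} (f : Fin n → ℝ) : Fin n → ℝ :=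
  f ∘ Tuple.sort (fun i => -(f i))

/-- The singular values of a complex square matrix, in nonincreasing order. -/
noncomputable def singVals {n : ℕ} (Y : Matrix (Fin n) (Fin n) ℂ) : Fin n → ℝ :=
  descSort (fun i => Real.sqrt ((Matrix.posSemidef_conjTranspose_mul_self Y).1.eigenvalues i))

/-- The orthogonal (spectral) projection onto the span of the eigenvectors of `F`
indexed by the set `s`, in an orthonormal eigenbasis of the Hermitian matrix `F`. -/
noncomputable def specProj {n : ℕ} {F : Matrix (Fin n) (Fin n) ℂ} (hF : F.IsHermitian)
    (s : Finset (Fin n)) : Matrix (Fin n) (Fin n) ℂ :=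
  (hF.eigenvectorUnitary : Matrix (Fin n) (Fin n) ℂ) *
    Matrix.diagonal (fun i => if i ∈ s then (1:ℂ) else 0) *
    (hF.eigenvectorUnitary : Matrix (Fin n) (Fin n) ℂ)ᴴ

/-- The sum of the `r` largest values of `f` is attained on a set of `r` indices whose values
dominate all the others. -/
theorem exists_top_set_sum_descSort {n : ℕ} (f : Fin n → ℝ) (r : ℕ) (hr : r ≤ n) :
    ∃ T : Finset (Fin n), T.card = r ∧ (∀ i ∈ T, ∀ j ∉ T, f j ≤ f i) ∧
      ∑ j ∈ Finset.univ.filter (fun j : Fin n => (j : ℕ) < r), descSort f j = ∑ i ∈ T, f i := by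
  set e := Tuple.sort (fun i => -(f i)) with he
  refine ⟨(Finset.univ.filter (fun j : Fin n => (j : ℕ) < r)).map e.toEmbedding, ?_, ?_, ?_⟩
  · rw [Finset.card_map, Fin.card_filter_val_lt]
    exact min_eq_right hr
  · intro i hi j hj
    simp only [Finset.mem_map_equiv, Finset.mem_filter, Finset.mem_univ, true_and, not_lt]
      at hi hj
    have h := Tuple.monotone_sort (fun i => -(f i))
      (show e.symm i ≤ e.symm j from Fin.le_def.2 (hi.le.trans hj))
    simpa [← he] using h
  · rw [Finset.sum_map]
    rfl

/-- A weighted sum with weights in `[0, 1]` of total mass at most `|T|` is at most the sum over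
a set `T` carrying the largest values. -/
theorem sum_mul_le_sum_of_top_set {ι : Type*} [Fintype ι] [DecidableEq ι] (f t : ι → ℝ)
    (hf : ∀ i, 0 ≤ f i) (ht0 : ∀ i, 0 ≤ t i) (ht1 : ∀ i, t i ≤ 1) (T : Finset ι)
    (hT : ∀ i ∈ T, ∀ j ∉ T, f j ≤ f i) (hsum : ∑ i, t i ≤ T.card) :
    ∑ i, f i * t i ≤ ∑ i ∈ T, f i := by
  obtain ⟨θ, hθ0, hθT, hθC⟩ :
      ∃ θ : ℝ, θ * ∑ i, t i ≤ θ * T.card ∧ (∀ i ∈ T, θ ≤ f i) ∧ (∀ j ∉ T, f j ≤ θ) := by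
    rcases T.eq_empty_or_nonempty with rfl | hne
    · have h0 : ∑ i, t i = 0 :=
        le_antisymm (by simpa using hsum) (Finset.sum_nonneg fun i _ => ht0 i)
      refine ⟨∑ i, f i, by simp [h0], by simp, fun j _ => ?_⟩
      exact Finset.single_le_sum (fun i _ => hf i) (Finset.mem_univ j)
    · obtain ⟨m, hm, hmin⟩ := T.exists_min_image f hne
      exact ⟨f m, mul_le_mul_of_nonneg_left hsum (hf m), hmin, fun j hj => hT m hm j hj⟩
  have key : ∑ i, (f i - θ) * t i ≤ ∑ i, if i ∈ T then f i - θ else 0 := by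
    refine Finset.sum_le_sum fun i _ => ?_
    split_ifs with hi
    · exact mul_le_of_le_one_right (sub_nonneg.2 (hθT i hi)) (ht1 i)
    · exact mul_nonpos_of_nonpos_of_nonneg (sub_nonpos.2 (hθC i hi)) (ht0 i)
  rw [Finset.sum_ite_mem, Finset.univ_inter, Finset.sum_sub_distrib, Finset.sum_const,
    nsmul_eq_mul] at key
  simp only [sub_mul, Finset.sum_sub_distrib, ← Finset.mul_sum] at key
  linarith

theorem exists_pow_three_eq (x : ℝ) : ∃ c : ℝ, c ^ 3 = x := by
  have h : ∀ y : ℝ, 0 ≤ y → (y ^ (((3 : ℕ) : ℝ)⁻¹)) ^ 3 = y := fun y hy =>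
    Real.rpow_inv_natCast_pow hy three_ne_zero
  rcases le_total 0 x with hx | hx
  · exact ⟨_, h x hx⟩
  · exact ⟨_, by rw [Odd.neg_pow (by decide), h (-x) (neg_nonneg.2 hx), neg_neg]⟩

namespace Matrix

variable {ι : Type*} [Fintype ι]

theorem conjTranspose_mul_self_apply_self (M : Matrix ι ι ℂ) (k : ι) :
    (Mᴴ * M) k k = ((∑ i, ‖M i k‖ ^ 2 : ℝ) : ℂ) := by
  simp [Complex.conj_mul', mul_apply]

theorem mul_conjTranspose_self_apply_self (M : Matrix ι ι ℂ) (i : ι) :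
    (M * Mᴴ) i i = ((∑ k, ‖M i k‖ ^ 2 : ℝ) : ℂ) := by
  simp [Complex.mul_conj', mul_apply]

/-- The rows of a partial isometry have norm at most one. -/
theorem sum_norm_sq_row_le_one_of_mul_conjTranspose_mul_self {Y : Matrix ι ι ℂ}
    (hY : Y * Yᴴ * Y = Y) (i : ι) : ∑ k, ‖Y i k‖ ^ 2 ≤ 1 := by
  set P := Y * Yᴴ with hP
  have hPP : P * Pᴴ = P := by
    rw [hP, conjTranspose_mul, conjTranspose_conjTranspose, ← mul_assoc, hY]
  have h1 := mul_conjTranspose_self_apply_self P i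
  have h2 := mul_conjTranspose_self_apply_self Y i
  rw [hPP, hP, h2, ← hP] at h1
  have h3 : ∑ k, ‖Y i k‖ ^ 2 = ∑ k, ‖P i k‖ ^ 2 := by exact_mod_cast h1
  have h4 : ‖P i i‖ ^ 2 ≤ ∑ k, ‖P i k‖ ^ 2 :=
    Finset.single_le_sum (f := fun k => ‖P i k‖ ^ 2) (fun k _ => by positivity) (Finset.mem_univ i)
  have h0 : 0 ≤ ∑ k, ‖Y i k‖ ^ 2 := Finset.sum_nonneg fun k _ => by positivity
  have h5 : ‖P i i‖ = ∑ k, ‖Y i k‖ ^ 2 := by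
    rw [hP, h2, Complex.norm_real, Real.norm_of_nonneg h0]
  rw [h5] at h4
  nlinarith

variable [DecidableEq ι]

/-- Columns that are orthogonal with norms `s k` factor through a contraction. -/
theorem exists_factor_of_conjTranspose_mul_self_eq_diagonal {Z : Matrix ι ι ℂ} {s : ι → ℝ}
    (hZ : Zᴴ * Z = diagonal fun k => ((s k ^ 2 : ℝ) : ℂ)) :
    ∃ Y : Matrix ι ι ℂ, (∀ i k, Z i k = s k * Y i k) ∧ (∀ k, ∑ i, ‖Y i k‖ ^ 2 ≤ 1) ∧
      ∀ i, ∑ k, ‖Y i k‖ ^ 2 ≤ 1 := by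
  have hcol : ∀ k, ∑ i, ‖Z i k‖ ^ 2 = s k ^ 2 := fun k => by
    have h := conjTranspose_mul_self_apply_self Z k
    rw [hZ, diagonal_apply_eq] at h
    exact_mod_cast h.symm
  set d : ι → ℂ := fun k => (s k : ℂ)⁻¹ with hd
  have hYY : (Z * diagonal d)ᴴ * (Z * diagonal d) =
      diagonal fun k => if s k = 0 then (0 : ℂ) else 1 := by
    rw [conjTranspose_mul, mul_assoc, ← mul_assoc Zᴴ, hZ, diagonal_conjTranspose,
      diagonal_mul_diagonal, diagonal_mul_diagonal]
    congr 1
    funext k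
    by_cases hk : s k = 0
    · simp [hd, hk]
    · have : (s k : ℂ) ≠ 0 := by exact_mod_cast hk
      simp only [hd, Pi.star_apply, star_inv₀, Complex.star_def, Complex.conj_ofReal, if_neg hk]
      push_cast
      field_simp
  refine ⟨Z * diagonal d, fun i k => ?_, fun k => ?_, ?_⟩
  · rw [mul_diagonal]
    by_cases hk : s k = 0
    · have h0 := hcol k
      rw [hk, zero_pow two_ne_zero, Finset.sum_eq_zero_iff_of_nonneg fun _ _ => by positivity]
        at h0
      have := h0 i (Finset.mem_univ i)
      simp only [ne_eq, OfNat.ofNat_ne_zero, not_false_eq_true, pow_eq_zero_iff, norm_eq_zero]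
        at this
      simp [this]
    · have : (s k : ℂ) ≠ 0 := by exact_mod_cast hk
      simp only [hd]
      field_simp
  · have h := conjTranspose_mul_self_apply_self (Z * diagonal d) k
    rw [hYY, diagonal_apply_eq] at h
    have h' : (if s k = 0 then (0 : ℝ) else 1) = ∑ i, ‖(Z * diagonal d) i k‖ ^ 2 := by
      have := congrArg Complex.re h
      rw [Complex.ofReal_re] at this
      rw [← this]
      split_ifs <;> simp
    rw [← h']
    split_ifs <;> simp
  · refine sum_norm_sq_row_le_one_of_mul_conjTranspose_mul_self ?_
    rw [mul_assoc, hYY, mul_assoc, diagonal_mul_diagonal]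
    congr 2
    funext k
    by_cases hk : s k = 0 <;> simp [hd, hk]

/-- An eigenvector of the cube of a Hermitian matrix with real eigenvalue `c ^ 3` is an
eigenvector of the matrix with eigenvalue `c`. -/
theorem IsHermitian.mulVec_eq_smul_of_cube {H : Matrix ι ι ℂ} (hH : H.IsHermitian) (c : ℝ)
    (v : ι → ℂ) (hv : (H ^ 3) *ᵥ v = ((c : ℂ) ^ 3) • v) : H *ᵥ v = (c : ℂ) • v := by
  have adj : ∀ x y : ι → ℂ, star (H *ᵥ x) ⬝ᵥ y = star x ⬝ᵥ (H *ᵥ y) := fun x y => by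
    rw [star_mulVec, hH.eq, dotProduct_mulVec]
  have hv' : H *ᵥ H *ᵥ H *ᵥ v = ((c : ℂ) ^ 3) • v := by
    rw [← hv, mulVec_mulVec, mulVec_mulVec, pow_three, mul_assoc]
  by_cases hc : c = 0
  · subst hc
    have h3 : H *ᵥ H *ᵥ H *ᵥ v = 0 := by simpa using hv'
    have h2 : H *ᵥ H *ᵥ v = 0 := by
      rw [← dotProduct_star_self_eq_zero, adj, h3, dotProduct_zero]
    have h1 : H *ᵥ v = 0 := by
      rw [← dotProduct_star_self_eq_zero, adj, h2, dotProduct_zero]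
    simpa using h1
  · set w := H *ᵥ v - (c : ℂ) • v with hw
    have hq : H *ᵥ H *ᵥ w + (c : ℂ) • (H *ᵥ w) + ((c : ℂ) ^ 2) • w = 0 := by
      simp only [hw, mulVec_sub, mulVec_smul, hv']
      module
    set z := H *ᵥ w + ((c / 2 : ℝ) : ℂ) • w with hz
    have hzz : star z ⬝ᵥ z + ((3 / 4 * c ^ 2 : ℝ) : ℂ) * (star w ⬝ᵥ w) = 0 := by
      have h := congrArg (fun x => star w ⬝ᵥ x) hq
      simp only [dotProduct_add, dotProduct_smul, dotProduct_zero, smul_eq_mul] at h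
      rw [← h, hz]
      simp only [star_add, star_smul, dotProduct_add, add_dotProduct, dotProduct_smul,
        smul_dotProduct, adj, smul_eq_mul, Complex.star_def, Complex.conj_ofReal]
      push_cast
      ring
    have h1 : 0 ≤ star z ⬝ᵥ z := dotProduct_star_self_nonneg z
    have h2 : 0 ≤ star w ⬝ᵥ w := dotProduct_star_self_nonneg w
    have hcpos : (0 : ℂ) < ((3 / 4 * c ^ 2 : ℝ) : ℂ) := by
      have : (0 : ℝ) < 3 / 4 * c ^ 2 := by positivity
      exact_mod_cast this
    have h3 := ((add_eq_zero_iff_of_nonneg h1 (mul_nonneg hcpos.le h2)).1 hzz).2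
    have h4 : star w ⬝ᵥ w = 0 := (mul_eq_zero.1 h3).resolve_left hcpos.ne'
    exact sub_eq_zero.1 (dotProduct_star_self_eq_zero.1 h4)

/-- For `D` real diagonal and `A` Hermitian, the diagonal entries of the polynomial
`A³ + 3A²B + 3AB² + B³` at `B = D - A`. -/
theorem re_binomialCube_diagonal_sub_apply_self {A : Matrix ι ι ℂ} (hA : A.IsHermitian)
    (c : ι → ℝ) (B : Matrix ι ι ℂ) (hB : A + B = diagonal fun i => (c i : ℂ)) (i : ι) :
    ((A ^ 3 + (3 : ℂ) • (A ^ 2 * B) + (3 : ℂ) • (A * B ^ 2) + B ^ 3) i i).re =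
      c i ^ 3 + 2 * ∑ j, (c i - c j) * ‖A i j‖ ^ 2 := by
  set D : Matrix ι ι ℂ := diagonal fun i => (c i : ℂ) with hD
  obtain rfl : B = D - A := by rw [← hB]; abel
  have hpoly : A ^ 3 + (3 : ℂ) • (A ^ 2 * (D - A)) + (3 : ℂ) • (A * (D - A) ^ 2) + (D - A) ^ 3 =
      D * D * D + (A * D * D + A * D * D - D * (D * A) - D * A * D) +
        (D * (A * A) + (A * A) * D - (A * (D * A) + A * (D * A))) := by
    simp only [pow_succ, pow_zero, one_mul, mul_sub, sub_mul, mul_assoc]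
    module
  have hsq : ∀ j, A i j * A j i = ((‖A i j‖ ^ 2 : ℝ) : ℂ) := fun j => by
    rw [← hA.apply j i, Complex.star_def, Complex.mul_conj']
    push_cast
    rfl
  have hAA : (A * A) i i = ((∑ j, ‖A i j‖ ^ 2 : ℝ) : ℂ) := by
    simp only [mul_apply, hsq, Complex.ofReal_sum]
  have hADA : (A * (D * A)) i i = ((∑ j, c j * ‖A i j‖ ^ 2 : ℝ) : ℂ) := by
    rw [mul_apply, Complex.ofReal_sum]
    refine Finset.sum_congr rfl fun j _ => ?_
    rw [hD, diagonal_mul, mul_left_comm, hsq, Complex.ofReal_mul]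
  have hent : (A ^ 3 + (3 : ℂ) • (A ^ 2 * (D - A)) + (3 : ℂ) • (A * (D - A) ^ 2) +
      (D - A) ^ 3) i i = ((c i ^ 3 + 2 * ∑ j, (c i - c j) * ‖A i j‖ ^ 2 : ℝ) : ℂ) := by
    rw [hpoly]
    simp only [add_apply, sub_apply, hADA]
    simp only [hD, mul_diagonal, diagonal_mul, diagonal_apply_eq, hAA, sub_mul,
      Finset.sum_sub_distrib, ← Finset.mul_sum]
    push_cast
    ring
  rw [hent, Complex.ofReal_re]

/-- Antisymmetric cancellation: only the pairs leaving the top set contribute. -/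
theorem sum_sum_sub_mul_nonneg_of_top_set (c : ι → ℝ) (g : ι → ι → ℝ)
    (hg : ∀ i j, 0 ≤ g i j) (hsymm : ∀ i j, g i j = g j i) (S : Finset ι)
    (hS : ∀ i ∈ S, ∀ j ∉ S, c j ≤ c i) : 0 ≤ ∑ i ∈ S, ∑ j, (c i - c j) * g i j := by
  have hin : ∑ i ∈ S, ∑ j ∈ S, (c i - c j) * g i j = 0 := by
    have h : ∑ i ∈ S, ∑ j ∈ S, (c i - c j) * g i j =
        -∑ i ∈ S, ∑ j ∈ S, (c i - c j) * g i j := by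
      conv_lhs => rw [Finset.sum_comm]
      simp only [← Finset.sum_neg_distrib]
      refine Finset.sum_congr rfl fun i _ => Finset.sum_congr rfl fun j _ => ?_
      rw [hsymm j i]
      ring
    linarith
  have hsplit : ∀ i, ∑ j, (c i - c j) * g i j =
      ∑ j ∈ S, (c i - c j) * g i j + ∑ j ∈ Sᶜ, (c i - c j) * g i j := fun i =>
    (Finset.sum_add_sum_compl S _).symm
  simp only [hsplit, Finset.sum_add_distrib, hin, zero_add]
  exact Finset.sum_nonneg fun i hi => Finset.sum_nonneg fun j hj =>
    mul_nonneg (sub_nonneg.2 (hS i hi j (Finset.mem_compl.1 hj))) (hg i j)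

end Matrix

/-- **Ky Fan's inequality**: a sum of `r` diagonal entries of `Q` in an orthonormal basis is at
most the sum of the `r` largest singular values of `Q`. -/
theorem sum_re_diag_unitary_conj_le_sum_singVals {n : ℕ} (Q U : Matrix (Fin n) (Fin n) ℂ)
    (hU : Uᴴ * U = 1) (S : Finset (Fin n)) :
    ∑ i ∈ S, ((Uᴴ * Q * U) i i).re ≤
      ∑ j ∈ Finset.univ.filter (fun j : Fin n => (j : ℕ) < S.card), singVals Q j := by
  have hUU : U * Uᴴ = 1 := mul_eq_one_comm.1 hU
  have hQQ := Matrix.posSemidef_conjTranspose_mul_self Q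
  set s : Fin n → ℝ := fun i => Real.sqrt (hQQ.1.eigenvalues i) with hs
  obtain ⟨T, hTcard, hT, hsum⟩ := exists_top_set_sum_descSort s S.card
    (by simpa using S.card_le_univ)
  have hgoal : ∑ j ∈ Finset.univ.filter (fun j : Fin n => (j : ℕ) < S.card), singVals Q j =
    ∑ i ∈ T, s i := hsum
  rw [hgoal]
  set V : Matrix (Fin n) (Fin n) ℂ := (hQQ.1.eigenvectorUnitary : Matrix (Fin n) (Fin n) ℂ) with hV
  have hVV : Vᴴ * V = 1 := Unitary.coe_star_mul_self hQQ.1.eigenvectorUnitary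
  have hVV' : V * Vᴴ = 1 := mul_eq_one_comm.1 hVV
  have hspec : Qᴴ * Q = V * diagonal (fun k => ((s k ^ 2 : ℝ) : ℂ)) * Vᴴ := by
    have h := hQQ.1.spectral_theorem
    rw [Unitary.conjStarAlgAut_apply] at h
    have hsq : (fun k => ((s k ^ 2 : ℝ) : ℂ)) = RCLike.ofReal ∘ hQQ.1.eigenvalues := by
      funext k
      simp only [hs, Real.sq_sqrt (hQQ.eigenvalues_nonneg k)]
      rfl
    rw [hsq]
    exact h
  have hZ : (Uᴴ * Q * V)ᴴ * (Uᴴ * Q * V) = diagonal (fun k => ((s k ^ 2 : ℝ) : ℂ)) := by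
    calc (Uᴴ * Q * V)ᴴ * (Uᴴ * Q * V) = Vᴴ * (Qᴴ * (U * Uᴴ) * Q) * V := by
          simp only [conjTranspose_mul, conjTranspose_conjTranspose, Matrix.mul_assoc]
      _ = (Vᴴ * V) * diagonal (fun k => ((s k ^ 2 : ℝ) : ℂ)) * (Vᴴ * V) := by
          rw [hUU, Matrix.mul_one, hspec]
          simp only [Matrix.mul_assoc]
      _ = _ := by rw [hVV, Matrix.one_mul, Matrix.mul_one]
  obtain ⟨Y, hYZ, hYcol, hYrow⟩ :=
    Matrix.exists_factor_of_conjTranspose_mul_self_eq_diagonal hZ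
  set X := Vᴴ * U with hX
  have hXX : Xᴴ * X = 1 := by
    rw [hX, conjTranspose_mul, conjTranspose_conjTranspose, Matrix.mul_assoc, ← Matrix.mul_assoc V,
      hVV', Matrix.one_mul, hU]
  have hXX' : X * Xᴴ = 1 := mul_eq_one_comm.1 hXX
  have hXcol : ∀ i, ∑ k, ‖X k i‖ ^ 2 = 1 := fun i => by
    have h := Matrix.conjTranspose_mul_self_apply_self X i
    rw [hXX, one_apply_eq] at h
    exact_mod_cast h.symm
  have hXrow : ∀ k, ∑ i, ‖X k i‖ ^ 2 = 1 := fun k => by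
    have h := Matrix.mul_conjTranspose_self_apply_self X k
    rw [hXX', one_apply_eq] at h
    exact_mod_cast h.symm
  have hM : Uᴴ * Q * U = (Uᴴ * Q * V) * X := by
    rw [hX, Matrix.mul_assoc _ V, ← Matrix.mul_assoc V, hVV', Matrix.one_mul]
  set t : Fin n → ℝ := fun k => ∑ i ∈ S, (‖Y i k‖ ^ 2 + ‖X k i‖ ^ 2) / 2 with ht
  have hs0 : ∀ k, 0 ≤ s k := fun k => Real.sqrt_nonneg _
  have hle : ∑ i ∈ S, ((Uᴴ * Q * U) i i).re ≤ ∑ k, s k * t k := by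
    simp only [ht, Finset.mul_sum]
    rw [Finset.sum_comm]
    refine Finset.sum_le_sum fun i _ => ?_
    rw [hM, mul_apply, Complex.re_sum]
    refine Finset.sum_le_sum fun k _ => ?_
    rw [hYZ, mul_assoc, Complex.re_ofReal_mul]
    refine mul_le_mul_of_nonneg_left ?_ (hs0 k)
    refine (Complex.re_le_norm _).trans ?_
    rw [norm_mul]
    nlinarith [sq_nonneg (‖Y i k‖ - ‖X k i‖)]
  refine hle.trans (sum_mul_le_sum_of_top_set s t hs0 (fun k => ?_) (fun k => ?_) T hT ?_)
  · exact Finset.sum_nonneg fun i _ => by positivity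
  · have h : t k ≤ ∑ i, (‖Y i k‖ ^ 2 + ‖X k i‖ ^ 2) / 2 :=
      Finset.sum_le_sum_of_subset_of_nonneg (Finset.subset_univ S) fun i _ _ => by positivity
    rw [← Finset.sum_div, Finset.sum_add_distrib, hXrow] at h
    linarith [hYcol k]
  · rw [hTcard]
    simp only [ht]
    rw [Finset.sum_comm]
    have h : ∀ i ∈ S, ∑ k, (‖Y i k‖ ^ 2 + ‖X k i‖ ^ 2) / 2 ≤ 1 := fun i _ => by
      rw [← Finset.sum_div, Finset.sum_add_distrib, hXcol]
      linarith [hYrow i]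
    simpa using Finset.sum_le_sum h

/-- `λ(H³) ≺_w σ(Q₃)`. -/
theorem eig_cube_weakly_majorized_by_sing_Q3 {n : ℕ} (A B : Matrix (Fin n) (Fin n) ℂ)
    (hA : A.IsHermitian) (hB : B.IsHermitian)
    (hH3 : ((A + B) ^ 3).IsHermitian) :
    ∀ r : ℕ, r ≤ n →
      ∑ j ∈ Finset.univ.filter (fun j : Fin n => (j : ℕ) < r), descSort hH3.eigenvalues j ≤
        ∑ j ∈ Finset.univ.filter (fun j : Fin n => (j : ℕ) < r),
          singVals (A ^ 3 + (3 : ℂ) • (A ^ 2 * B) + (3 : ℂ) • (A * B ^ 2) + B ^ 3) j := by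
  intro r hr
  obtain ⟨S, rfl, hS, hsum⟩ := exists_top_set_sum_descSort hH3.eigenvalues r hr
  rw [hsum]
  set μ := hH3.eigenvalues with hμ
  obtain ⟨c, hc⟩ : ∃ c : Fin n → ℝ, ∀ i, c i ^ 3 = μ i := by
    choose c hc using fun i => exists_pow_three_eq (μ i)
    exact ⟨c, hc⟩
  set U : Matrix (Fin n) (Fin n) ℂ := (hH3.eigenvectorUnitary : Matrix (Fin n) (Fin n) ℂ) with hUdef
  have hU : Uᴴ * U = 1 := Unitary.coe_star_mul_self hH3.eigenvectorUnitary
  have hUU : U * Uᴴ = 1 := mul_eq_one_comm.1 hU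
  have hHU : (A + B) * U = U * diagonal fun i => (c i : ℂ) := by
    ext i j
    have h := (hA.add hB).mulVec_eq_smul_of_cube (c j) (U.col j) (by
      have h := hH3.mulVec_eigenvectorBasis j
      rw [← hμ, ← hc j] at h
      ext k
      have h' := congrFun h k
      simpa [hUdef] using h')
    have h' := congrFun h i
    rw [mul_diagonal, mul_comm]
    exact h'
  have hconj : ∀ M N : Matrix (Fin n) (Fin n) ℂ,
      Uᴴ * (M * N) * U = (Uᴴ * M * U) * (Uᴴ * N * U) := fun M N => by
    calc Uᴴ * (M * N) * U = Uᴴ * M * 1 * N * U := by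
          simp only [Matrix.mul_one, Matrix.mul_assoc]
      _ = _ := by rw [← hUU]; simp only [Matrix.mul_assoc]
  have hdiag : Uᴴ * A * U + Uᴴ * B * U = diagonal fun i => (c i : ℂ) := by
    rw [← Matrix.add_mul, ← Matrix.mul_add, Matrix.mul_assoc, hHU, ← Matrix.mul_assoc, hU,
      Matrix.one_mul]
  have hA' : (Uᴴ * A * U).IsHermitian := isHermitian_conjTranspose_mul_mul U hA
  have hQ : Uᴴ * (A ^ 3 + (3 : ℂ) • (A ^ 2 * B) + (3 : ℂ) • (A * B ^ 2) + B ^ 3) * U =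
      (Uᴴ * A * U) ^ 3 + (3 : ℂ) • ((Uᴴ * A * U) ^ 2 * (Uᴴ * B * U)) +
        (3 : ℂ) • ((Uᴴ * A * U) * (Uᴴ * B * U) ^ 2) + (Uᴴ * B * U) ^ 3 := by
    simp only [pow_three, pow_two, ← hconj, Matrix.mul_add, Matrix.add_mul, Matrix.mul_smul,
      Matrix.smul_mul]
  refine le_trans ?_ (sum_re_diag_unitary_conj_le_sum_singVals _ U hU S)
  rw [hQ]
  simp only [Matrix.re_binomialCube_diagonal_sub_apply_self hA' c _ hdiag, hc,
    Finset.sum_add_distrib, ← Finset.mul_sum]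
  have hcS : ∀ i ∈ S, ∀ j ∉ S, c j ≤ c i := fun i hi j hj => by
    have h := hS i hi j hj
    rw [← hc, ← hc] at h
    exact (Odd.strictMono_pow (n := 3) (by decide)).le_iff_le.1 h
  have h := Matrix.sum_sum_sub_mul_nonneg_of_top_set c (fun i j => ‖(Uᴴ * A * U) i j‖ ^ 2)
    (fun i j => by positivity) (fun i j => by rw [← hA'.apply i j, norm_star]) S hcS
  linarith
end

section
/- Let A, B be n×n Hermitian matrices, H = A + B, Q₄ = A⁴ + 4A³B + 6A²B² + 4AB³ + B⁴. Then the eigenvalue vector of H⁴ is weakly majorized by the singular value vector of Q₄. -/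
open Matrix BigOperators
open scoped ComplexOrder

lemma antitone_descSort {n : ℕ} (f : Fin n → ℝ) : Antitone (descSort f) := fun i j hij => by
  have := Tuple.monotone_sort (fun i => -(f i)) hij
  simpa [descSort] using this

/-- A sum of nonnegative reals with weights in `[0, 1]` of total mass at most `r` is at most the
sum of the `r` largest ones. -/
lemma sum_mul_le_sum_descSort {n r : ℕ} (hr : r ≤ n) (s c : Fin n → ℝ) (hs : ∀ j, 0 ≤ s j)
    (hc0 : ∀ j, 0 ≤ c j) (hc1 : ∀ j, c j ≤ 1) (hc : ∑ j, c j ≤ r) :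
    ∑ j, s j * c j ≤ ∑ j ∈ Finset.univ.filter (fun j : Fin n => (j : ℕ) < r), descSort s j := by
  set σ := Tuple.sort (fun i => -(s i))
  have hanti : Antitone fun j => s (σ j) := antitone_descSort s
  obtain ⟨t, ht0, htlt, htge⟩ : ∃ t : ℝ, 0 ≤ t ∧ (∀ j : Fin n, (j : ℕ) < r → t ≤ s (σ j)) ∧
      ∀ j : Fin n, r ≤ (j : ℕ) → s (σ j) ≤ t := by
    rcases Nat.eq_zero_or_pos r with rfl | hpos
    · exact ⟨∑ j, s j, Finset.sum_nonneg fun j _ => hs j, by simp, fun j _ =>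
        Finset.single_le_sum (fun i _ => hs i) (Finset.mem_univ _)⟩
    · refine ⟨s (σ ⟨r - 1, by omega⟩), hs _, fun j hj => hanti ?_, fun j hj => hanti ?_⟩ <;>
      · rw [Fin.le_def]
        simp only
        omega
  have hcard : (∑ j : Fin n, if (j : ℕ) < r then (1 : ℝ) else 0) = r := by
    rw [Finset.sum_boole, Fin.card_filter_val_lt, min_eq_right hr]
  have hterm : ∀ j : Fin n, s (σ j) * c (σ j) ≤
      (if (j : ℕ) < r then s (σ j) else 0) + t * (c (σ j) - if (j : ℕ) < r then 1 else 0) := by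
    intro j
    split_ifs with h
    · nlinarith [htlt j h, hc1 (σ j)]
    · nlinarith [htge j (not_lt.1 h), hc0 (σ j)]
  calc ∑ j, s j * c j = ∑ j, s (σ j) * c (σ j) := (Equiv.sum_comp σ fun j => s j * c j).symm
    _ ≤ _ := Finset.sum_le_sum fun j _ => hterm j
    _ = (∑ j ∈ Finset.univ.filter (fun j : Fin n => (j : ℕ) < r), descSort s j)
        + t * (∑ j, c j - r) := by
      rw [Finset.sum_add_distrib, ← Finset.mul_sum, Finset.sum_sub_distrib, hcard,
        Equiv.sum_comp σ c, Finset.sum_filter]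
      rfl
    _ ≤ _ := by nlinarith

/-- The rows of a partial isometry have norm at most `1`. -/
lemma sum_normSq_row_le_one {n : Type*} [Fintype n] (X : Matrix n n ℂ)
    (hX : X * Xᴴ * X = X) (i : n) : ∑ j, Complex.normSq (X i j) ≤ 1 := by
  set p := ∑ j, Complex.normSq (X i j) with hp
  have hdiag : (X * Xᴴ) i i = (p : ℂ) := by
    simp [Matrix.mul_apply, hp, Complex.mul_conj]
  have hidem : X * Xᴴ * (X * Xᴴ)ᴴ = X * Xᴴ := by
    rw [conjTranspose_mul, conjTranspose_conjTranspose, ← Matrix.mul_assoc, hX]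
  have hsum : ∑ j, Complex.normSq ((X * Xᴴ) i j) = p := by
    have h := congrFun (congrFun hidem i) i
    rw [hdiag, Matrix.mul_apply] at h
    simp only [conjTranspose_apply, RCLike.star_def, Complex.mul_conj] at h
    exact_mod_cast h
  have hle : Complex.normSq ((X * Xᴴ) i i) ≤ p :=
    (Finset.single_le_sum (f := fun j => Complex.normSq ((X * Xᴴ) i j))
      (fun j _ => Complex.normSq_nonneg _) (Finset.mem_univ i)).trans hsum.le
  rw [hdiag, Complex.normSq_ofReal] at hle
  have hp0 : 0 ≤ p := Finset.sum_nonneg fun j _ => Complex.normSq_nonneg _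
  nlinarith

/-- The columns of a partial isometry have norm at most `1`. -/
lemma sum_normSq_col_le_one {n : Type*} [Fintype n] (X : Matrix n n ℂ)
    (hX : X * Xᴴ * X = X) (j : n) : ∑ i, Complex.normSq (X i j) ≤ 1 := by
  have h : Xᴴ * Xᴴᴴ * Xᴴ = Xᴴ := by
    conv_rhs => rw [← hX]
    simp only [conjTranspose_mul, conjTranspose_conjTranspose, Matrix.mul_assoc]
  simpa using sum_normSq_row_le_one Xᴴ h j

lemma re_mul_ofReal_mul_star_le (x y : ℂ) {s : ℝ} (hs : 0 ≤ s) :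
    (x * s * star y).re ≤ s * ((Complex.normSq x + Complex.normSq y) / 2) := by
  have h : (x * s * star y).re = s * (x.re * y.re + x.im * y.im) := by
    simp
    ring
  rw [h, Complex.normSq_apply, Complex.normSq_apply]
  apply mul_le_mul_of_nonneg_left _ hs
  nlinarith [sq_nonneg (x.re - y.re), sq_nonneg (x.im - y.im)]

/-- Ky Fan's inequality for diagonal entries of a matrix in singular value form. -/
lemma sum_re_diag_le_sum_descSort {n : ℕ} (X Y : Matrix (Fin n) (Fin n) ℂ) (s : Fin n → ℝ)
    (hX : X * Xᴴ * X = X) (hY : Y * Yᴴ * Y = Y) (hs : ∀ j, 0 ≤ s j) (S : Finset (Fin n)) :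
    ∑ i ∈ S, ((X * diagonal (fun j => (s j : ℂ)) * Yᴴ) i i).re ≤
      ∑ j ∈ Finset.univ.filter (fun j : Fin n => (j : ℕ) < S.card), descSort s j := by
  set c : Fin n → ℝ := fun j =>
    ∑ i ∈ S, (Complex.normSq (X i j) + Complex.normSq (Y i j)) / 2 with hcdef
  have hle : ∑ i ∈ S, ((X * diagonal (fun j => (s j : ℂ)) * Yᴴ) i i).re ≤ ∑ j, s j * c j := by
    simp only [hcdef, Finset.mul_sum]
    rw [Finset.sum_comm]
    refine Finset.sum_le_sum fun i _ => ?_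
    rw [Matrix.mul_apply, Complex.re_sum]
    refine Finset.sum_le_sum fun j _ => ?_
    rw [mul_diagonal, conjTranspose_apply]
    exact re_mul_ofReal_mul_star_le _ _ (hs j)
  have hnn : ∀ i j, 0 ≤ (Complex.normSq (X i j) + Complex.normSq (Y i j)) / 2 := fun i j => by
    have := Complex.normSq_nonneg (X i j)
    have := Complex.normSq_nonneg (Y i j)
    positivity
  refine hle.trans (sum_mul_le_sum_descSort (by simpa using S.card_le_univ) s c hs
    (fun j => Finset.sum_nonneg fun i _ => hnn i j) (fun j => ?_) ?_)
  · refine (Finset.sum_le_sum_of_subset_of_nonneg S.subset_univ fun i _ _ => hnn i j).trans ?_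
    rw [← Finset.sum_div, Finset.sum_add_distrib]
    linarith [sum_normSq_col_le_one X hX j, sum_normSq_col_le_one Y hY j]
  · rw [hcdef, Finset.sum_comm, ← nsmul_one, ← Finset.sum_const]
    refine Finset.sum_le_sum fun i _ => ?_
    rw [← Finset.sum_div, Finset.sum_add_distrib]
    linarith [sum_normSq_row_le_one X hX i, sum_normSq_row_le_one Y hY i]

lemma conjTranspose_mul_mul_eq_diagonal_eigenvalues {n : Type*} [Fintype n] [DecidableEq n]
    {F : Matrix n n ℂ} (hF : F.IsHermitian) :
    (hF.eigenvectorUnitary : Matrix n n ℂ)ᴴ * F * (hF.eigenvectorUnitary : Matrix n n ℂ) =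
      diagonal (fun i => (hF.eigenvalues i : ℂ)) := by
  have h := hF.conjStarAlgAut_star_eigenvectorUnitary
  rw [Unitary.conjStarAlgAut_star_apply] at h
  exact h

/-- A singular value decomposition with a partial isometry on the left. -/
lemma exists_partialIsometry_mul_diagonal_mul {n : Type*} [Fintype n] [DecidableEq n]
    (Q : Matrix n n ℂ) :
    ∃ W V : Matrix n n ℂ, W * Wᴴ * W = W ∧ V * Vᴴ = 1 ∧ Q = W * diagonal (fun i =>
      ((Real.sqrt ((Matrix.posSemidef_conjTranspose_mul_self Q).1.eigenvalues i) : ℝ) : ℂ)) *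
        Vᴴ := by
  set hF := (Matrix.posSemidef_conjTranspose_mul_self Q).1
  set s : n → ℝ := fun i => Real.sqrt (hF.eigenvalues i) with hs
  set V : Matrix n n ℂ := (hF.eigenvectorUnitary : Matrix n n ℂ)
  have hVV : V * Vᴴ = 1 := Unitary.coe_mul_star_self hF.eigenvectorUnitary
  set M := Q * V with hM
  have hMM : Mᴴ * M = diagonal (fun i => ((s i : ℂ)) ^ 2) := by
    have h := conjTranspose_mul_mul_eq_diagonal_eigenvalues hF
    rw [hM, conjTranspose_mul, Matrix.mul_assoc, ← Matrix.mul_assoc Qᴴ, ← Matrix.mul_assoc]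
    refine h.trans ?_
    congr 1
    funext i
    rw [hs, ← Complex.ofReal_pow,
      Real.sq_sqrt ((Matrix.posSemidef_conjTranspose_mul_self Q).eigenvalues_nonneg i)]
  have hstar : ∀ d : n → ℝ, (diagonal (fun i => (d i : ℂ)))ᴴ = diagonal (fun i => (d i : ℂ)) := by
    intro d
    rw [diagonal_conjTranspose]
    congr 1
    funext i
    simp
  have hE : M * diagonal (fun i => (((s i)⁻¹ * s i : ℝ) : ℂ)) = M := by
    have hsub : M - M * diagonal (fun i => (((s i)⁻¹ * s i : ℝ) : ℂ)) =
        M * diagonal (fun i => ((1 - (s i)⁻¹ * s i : ℝ) : ℂ)) := by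
      ext i j
      simp only [Matrix.sub_apply, mul_diagonal]
      push_cast
      ring
    rw [eq_comm, ← sub_eq_zero, hsub, ← conjTranspose_mul_self_eq_zero, conjTranspose_mul, hstar,
      Matrix.mul_assoc, ← Matrix.mul_assoc Mᴴ, hMM]
    simp only [diagonal_mul_diagonal]
    rw [← diagonal_zero]
    congr 1
    funext i
    by_cases h : s i = 0
    · simp [h]
    · simp [h]
  refine ⟨M * diagonal (fun i => (((s i)⁻¹ : ℝ) : ℂ)), V, ?_, hVV, ?_⟩
  · rw [conjTranspose_mul, hstar]
    simp only [Matrix.mul_assoc]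
    rw [← Matrix.mul_assoc Mᴴ, hMM]
    simp only [diagonal_mul_diagonal]
    congr 2
    funext i
    by_cases h : s i = 0
    · simp [h]
    · push_cast
      field_simp
  · rw [Matrix.mul_assoc M, diagonal_mul_diagonal]
    have h := hE
    push_cast at h ⊢
    rw [h, hM, Matrix.mul_assoc, hVV, Matrix.mul_one]

/-- The sum of the real parts of the diagonal entries of `Q`, over a subset of an orthonormal
basis, is at most the corresponding sum of largest singular values. -/
lemma sum_re_diag_conj_le_sum_singVals {n : ℕ} (Q U : Matrix (Fin n) (Fin n) ℂ)
    (hU : U * Uᴴ = 1) (S : Finset (Fin n)) :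
    ∑ i ∈ S, ((Uᴴ * Q * U) i i).re ≤
      ∑ j ∈ Finset.univ.filter (fun j : Fin n => (j : ℕ) < S.card), singVals Q j := by
  obtain ⟨W, V, hW, hV, hQ⟩ := exists_partialIsometry_mul_diagonal_mul Q
  have hconj : ∀ X : Matrix (Fin n) (Fin n) ℂ, X * Xᴴ * X = X →
      (Uᴴ * X) * (Uᴴ * X)ᴴ * (Uᴴ * X) = Uᴴ * X := by
    intro X hX
    rw [conjTranspose_mul, conjTranspose_conjTranspose]
    calc Uᴴ * X * (Xᴴ * U) * (Uᴴ * X) = Uᴴ * (X * Xᴴ * (U * Uᴴ) * X) := by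
          simp only [Matrix.mul_assoc]
      _ = _ := by rw [hU, Matrix.mul_one, hX]
  have h := sum_re_diag_le_sum_descSort (Uᴴ * W) (Uᴴ * V) _ (hconj W hW)
    (hconj V (by rw [hV, Matrix.one_mul])) (fun i => Real.sqrt_nonneg
      ((Matrix.posSemidef_conjTranspose_mul_self Q).1.eigenvalues i)) S
  refine le_trans (le_of_eq ?_) h
  refine Finset.sum_congr rfl fun i _ => ?_
  congr 2
  conv_lhs => rw [hQ]
  simp only [conjTranspose_mul, conjTranspose_conjTranspose, Matrix.mul_assoc]

lemma quartic_eq_commutator_expansion {R : Type*} [Ring R] (A H C K : R)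
    (hC : C = A * H - H * A) (hK : K = A * C - C * A) :
    A ^ 4 + 4 • (A ^ 3 * (H - A)) + 6 • (A ^ 2 * (H - A) ^ 2) + 4 • (A * (H - A) ^ 3)
      + (H - A) ^ 4 =
    H ^ 4 + (3 • (C * C) + 3 • (K * H) + H * K) + (A * K - K * A) + (A * H ^ 3 - H ^ 3 * A)
      + (A * H ^ 2 - H ^ 2 * A) * H + C * H ^ 2 := by
  subst hK hC
  noncomm_ring

/-- Diagonal entries of `A⁴ + 4A³B + 6A²B² + 4AB³ + B⁴` when `A + B` is diagonal. -/
lemma re_quartic_diag {n : Type*} [Fintype n] [DecidableEq n] (A B : Matrix n n ℂ) (h : n → ℝ)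
    (hA : A.IsHermitian) (hAB : A + B = diagonal (fun i => (h i : ℂ))) (i : n) :
    ((A ^ 4 + (4 : ℂ) • (A ^ 3 * B) + (6 : ℂ) • (A ^ 2 * B ^ 2)
        + (4 : ℂ) • (A * B ^ 3) + B ^ 4) i i).re =
      h i ^ 4 + ∑ j, Complex.normSq (A i j) * ((h i - h j) ^ 2 + 4 * (h i ^ 2 - h j ^ 2)) := by
  set D : Matrix n n ℂ := diagonal (fun i => (h i : ℂ)) with hD
  obtain rfl : B = D - A := by rw [← hAB]; abel
  set C := A * D - D * A with hC
  set K := A * C - C * A with hK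
  have hDH : Dᴴ = D := by
    rw [hD, diagonal_conjTranspose]
    congr 1
    funext i
    simp
  have hCH : Cᴴ = -C := by
    rw [hC, conjTranspose_sub, conjTranspose_mul, conjTranspose_mul, hDH, hA.eq, neg_sub]
  have hKH : Kᴴ = K := by
    rw [hK, conjTranspose_sub, conjTranspose_mul, conjTranspose_mul, hCH, hA.eq]
    noncomm_ring
  have hskew : ((A * K - K * A) i i).re = 0 := by
    have h1 : (A * K - K * A)ᴴ = -(A * K - K * A) := by
      rw [conjTranspose_sub, conjTranspose_mul, conjTranspose_mul, hKH, hA.eq, neg_sub]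
    have h2 := congrArg Complex.re (congrFun (congrFun h1 i) i)
    simp only [conjTranspose_apply, RCLike.star_def, Complex.conj_re, Matrix.neg_apply,
      Complex.neg_re] at h2
    linarith
  have hCij : ∀ i j, C i j = A i j * (h j - h i) := by
    intro i j
    rw [hC, Matrix.sub_apply, hD, mul_diagonal, diagonal_mul]
    ring
  have hAA : ∀ j, A i j * A j i = (Complex.normSq (A i j) : ℂ) := by
    intro j
    rw [← hA.apply j i, RCLike.star_def, Complex.mul_conj]
  have hCC : (C * C) i i = ((-∑ j, Complex.normSq (A i j) * (h i - h j) ^ 2 : ℝ) : ℂ) := by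
    rw [Matrix.mul_apply, ← Finset.sum_neg_distrib, Complex.ofReal_sum]
    refine Finset.sum_congr rfl fun j _ => ?_
    push_cast
    rw [hCij, hCij, ← hAA]
    ring
  have hKii : K i i = ((∑ j, Complex.normSq (A i j) * (2 * (h i - h j)) : ℝ) : ℂ) := by
    rw [hK, Matrix.sub_apply, Matrix.mul_apply, Matrix.mul_apply, ← Finset.sum_sub_distrib,
      Complex.ofReal_sum]
    refine Finset.sum_congr rfl fun j _ => ?_
    push_cast
    rw [hCij, hCij, ← hAA]
    ring
  have hpow : ∀ k : ℕ, D ^ k = diagonal (fun i => (h i : ℂ) ^ k) := fun k => by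
    rw [hD, diagonal_pow]
    rfl
  have hexp := quartic_eq_commutator_expansion A D C K hC hK
  have hsmul4 : ∀ X : Matrix n n ℂ, (4 : ℂ) • X = 4 • X := fun X => ofNat_smul_eq_nsmul ℂ 4 X
  have hsmul6 : ∀ X : Matrix n n ℂ, (6 : ℂ) • X = 6 • X := fun X => ofNat_smul_eq_nsmul ℂ 6 X
  rw [hsmul4, hsmul4, hsmul6, hexp]
  simp only [Matrix.add_apply, Complex.add_re, hskew]
  have e1 : ((A * D ^ 3 - D ^ 3 * A) i i) = 0 := by
    rw [Matrix.sub_apply, hpow, mul_diagonal, diagonal_mul]; ring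
  have e2 : (((A * D ^ 2 - D ^ 2 * A) * D) i i) = 0 := by
    rw [hpow, hD, mul_diagonal, Matrix.sub_apply, mul_diagonal, diagonal_mul]; ring
  have e3 : (C * D ^ 2) i i = 0 := by
    rw [hpow, mul_diagonal, hCij]; ring
  have e4 : (D ^ 4) i i = ((h i ^ 4 : ℝ) : ℂ) := by
    rw [hpow, diagonal_apply_eq]; push_cast; rfl
  have e5 : (K * D) i i = ((h i * ∑ j, Complex.normSq (A i j) * (2 * (h i - h j)) : ℝ) : ℂ) := by
    rw [hD, mul_diagonal, hKii]; push_cast; ring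
  have e6 : (D * K) i i = ((h i * ∑ j, Complex.normSq (A i j) * (2 * (h i - h j)) : ℝ) : ℂ) := by
    rw [hD, diagonal_mul, hKii]; push_cast; ring
  rw [e1, e2, e3, e4, e6, Matrix.smul_apply, Matrix.smul_apply, e5, hCC, Complex.re_nsmul,
    Complex.re_nsmul]
  simp only [Complex.ofReal_re, Complex.zero_re, add_zero, nsmul_eq_mul, Nat.cast_ofNat,
    Finset.mul_sum, ← Finset.sum_neg_distrib, add_assoc, ← Finset.sum_add_distrib]
  congr 1
  refine Finset.sum_congr rfl fun j _ => ?_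
  ring

/-- If every `hᵢ` with `i ∈ S` dominates every `hⱼ` with `j ∉ S` in modulus, the correction term
in the diagonal of the quartic sums to a nonnegative number. -/
lemma sum_correction_nonneg {n : Type*} [Fintype n] [DecidableEq n] (w : n → n → ℝ) (h : n → ℝ)
    (hw : ∀ i j, 0 ≤ w i j) (hsymm : ∀ i j, w i j = w j i) (S : Finset n)
    (hS : ∀ i ∈ S, ∀ j ∉ S, h j ^ 2 ≤ h i ^ 2) :
    0 ≤ ∑ i ∈ S, ∑ j, w i j * ((h i - h j) ^ 2 + 4 * (h i ^ 2 - h j ^ 2)) := by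
  have hanti : ∑ i ∈ S, ∑ j ∈ S, w i j * (h i ^ 2 - h j ^ 2) = 0 := by
    have hswap : ∑ i ∈ S, ∑ j ∈ S, w i j * (h i ^ 2 - h j ^ 2) =
        -∑ i ∈ S, ∑ j ∈ S, w i j * (h i ^ 2 - h j ^ 2) := by
      conv_lhs => rw [Finset.sum_comm]
      simp only [← Finset.sum_neg_distrib]
      refine Finset.sum_congr rfl fun i _ => Finset.sum_congr rfl fun j _ => ?_
      rw [hsymm j i]
      ring
    linarith
  have hsplit : ∑ i ∈ S, ∑ j, w i j * ((h i - h j) ^ 2 + 4 * (h i ^ 2 - h j ^ 2)) =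
      ∑ i ∈ S, ∑ j, w i j * (h i - h j) ^ 2
        + 4 * (∑ i ∈ S, ∑ j ∈ S, w i j * (h i ^ 2 - h j ^ 2)
          + ∑ i ∈ S, ∑ j ∈ Sᶜ, w i j * (h i ^ 2 - h j ^ 2)) := by
    rw [← Finset.sum_add_distrib]
    simp only [Finset.sum_add_sum_compl]
    simp only [Finset.mul_sum, ← Finset.sum_add_distrib]
    refine Finset.sum_congr rfl fun i _ => Finset.sum_congr rfl fun j _ => ?_
    ring
  rw [hsplit, hanti, zero_add]
  refine add_nonneg (Finset.sum_nonneg fun i _ => Finset.sum_nonneg fun j _ =>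
    mul_nonneg (hw i j) (sq_nonneg _)) (mul_nonneg (by norm_num) (Finset.sum_nonneg fun i hi =>
      Finset.sum_nonneg fun j hj => mul_nonneg (hw i j) (sub_nonneg.2 (hS i hi j ?_))))
  exact Finset.mem_compl.1 hj

/-- Two finite families with the same multiset of values agree up to a permutation. -/
lemma exists_perm_of_map_univ_eq {α β : Type*} [Fintype α] {f g : α → β}
    (h : Finset.univ.val.map f = Finset.univ.val.map g) :
    ∃ σ : Equiv.Perm α, ∀ a, f a = g (σ a) := by
  classical
  have hcard : ∀ b, Fintype.card {a // f a = b} = Fintype.card {a // g a = b} := by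
    intro b
    have hb := congrArg (Multiset.count b) h
    simp only [Multiset.count_map, ← Finset.filter_val, Finset.card_val] at hb
    simpa only [Fintype.card_subtype, eq_comm] using hb
  exact ⟨Equiv.ofFiberEquiv fun b => Fintype.equivOfCardEq (hcard b),
    fun a => (Equiv.ofFiberEquiv_map _ a).symm⟩

/-- The eigenvalues of `F ^ k` are the `k`-th powers of those of `F`, up to a permutation. -/
lemma exists_perm_eigenvalues_pow {n : Type*} [Fintype n] [DecidableEq n] {F : Matrix n n ℂ}
    (hF : F.IsHermitian) (k : ℕ) (hFk : (F ^ k).IsHermitian) :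
    ∃ σ : Equiv.Perm n, ∀ i, hFk.eigenvalues i = hF.eigenvalues (σ i) ^ k := by
  have hdiag : F ^ k = (hF.eigenvectorUnitary : Matrix n n ℂ) *
      diagonal (fun i => (hF.eigenvalues i : ℂ) ^ k) *
        star (hF.eigenvectorUnitary : Matrix n n ℂ) := by
    conv_lhs => rw [hF.spectral_theorem, ← map_pow, Unitary.conjStarAlgAut_apply, diagonal_pow]
    rfl
  have hroots : (F ^ k).charpoly.roots =
      Finset.univ.val.map (fun i => (hF.eigenvalues i : ℂ) ^ k) := by
    rw [hdiag, charpoly_mul_comm, ← Matrix.mul_assoc, Unitary.coe_star_mul_self, Matrix.one_mul,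
      charpoly_diagonal]
    simpa [Multiset.map_map] using Polynomial.roots_multiset_prod_X_sub_C
      (Finset.univ.val.map fun i => (hF.eigenvalues i : ℂ) ^ k)
  rw [hFk.roots_charpoly_eq_eigenvalues] at hroots
  obtain ⟨σ, hσ⟩ := exists_perm_of_map_univ_eq hroots
  exact ⟨σ, fun i =>
    Complex.ofReal_injective ((hσ i).trans (Complex.ofReal_pow _ _).symm)⟩

/-- `λ(H⁴) ≺_w σ(Q₄)`. -/
theorem eig_fourth_weakly_majorized_by_sing_Q4 {n : ℕ} (A B : Matrix (Fin n) (Fin n) ℂ)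
    (hA : A.IsHermitian) (hB : B.IsHermitian)
    (hH4 : ((A + B) ^ 4).IsHermitian) :
    ∀ r : ℕ, r ≤ n →
      ∑ j ∈ Finset.univ.filter (fun j : Fin n => (j : ℕ) < r), descSort hH4.eigenvalues j ≤
        ∑ j ∈ Finset.univ.filter (fun j : Fin n => (j : ℕ) < r),
          singVals (A ^ 4 + (4 : ℂ) • (A ^ 3 * B) + (6 : ℂ) • (A ^ 2 * B ^ 2)
            + (4 : ℂ) • (A * B ^ 3) + B ^ 4) j := by
  intro r hr
  have hH : (A + B).IsHermitian := hA.add hB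
  obtain ⟨σ, hσ⟩ := exists_perm_eigenvalues_pow hH 4 hH4
  set τ : Equiv.Perm (Fin n) := (Tuple.sort fun i => -(hH4.eigenvalues i)).trans σ
  set h := hH.eigenvalues
  have hdesc : ∀ j, descSort hH4.eigenvalues j = h (τ j) ^ 4 := fun j => hσ _
  set S := (Finset.univ.filter (fun j : Fin n => (j : ℕ) < r)).map τ.toEmbedding with hSdef
  have hcard : S.card = r := by
    rw [hSdef, Finset.card_map, Fin.card_filter_val_lt, min_eq_right hr]
  have hmem : ∀ j, τ j ∈ S ↔ (j : ℕ) < r := by simp [hSdef]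
  have hS : ∀ i ∈ S, ∀ j ∉ S, h j ^ 2 ≤ h i ^ 2 := by
    intro i hi j hj
    obtain ⟨i, rfl⟩ := τ.surjective i
    obtain ⟨j, rfl⟩ := τ.surjective j
    rw [hmem] at hi hj
    have hle := antitone_descSort hH4.eigenvalues (show i ≤ j by rw [Fin.le_def]; omega)
    rw [hdesc, hdesc] at hle
    exact le_of_sq_le_sq (by linarith) (sq_nonneg _)
  set φ := Unitary.conjStarAlgAut ℂ (Matrix (Fin n) (Fin n) ℂ) (star hH.eigenvectorUnitary)
  have hφA : (φ A).IsHermitian := IsSelfAdjoint.map hA φ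
  have hφAB : φ A + φ B = diagonal (fun i => (h i : ℂ)) := by
    rw [← map_add]
    exact hH.conjStarAlgAut_star_eigenvectorUnitary
  have hKF := sum_re_diag_conj_le_sum_singVals (A ^ 4 + (4 : ℂ) • (A ^ 3 * B)
    + (6 : ℂ) • (A ^ 2 * B ^ 2) + (4 : ℂ) • (A * B ^ 3) + B ^ 4)
    hH.eigenvectorUnitary (Unitary.coe_mul_star_self hH.eigenvectorUnitary) S
  rw [hcard] at hKF
  refine le_trans ?_ hKF
  have hentry : ∀ i, (((hH.eigenvectorUnitary : Matrix (Fin n) (Fin n) ℂ)ᴴ * (A ^ 4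
      + (4 : ℂ) • (A ^ 3 * B) + (6 : ℂ) • (A ^ 2 * B ^ 2) + (4 : ℂ) • (A * B ^ 3) + B ^ 4) *
      (hH.eigenvectorUnitary : Matrix (Fin n) (Fin n) ℂ)) i i).re = h i ^ 4 + ∑ j,
        Complex.normSq (φ A i j) * ((h i - h j) ^ 2 + 4 * (h i ^ 2 - h j ^ 2)) := by
    intro i
    rw [← re_quartic_diag (φ A) (φ B) h hφA hφAB i]
    simp only [← map_pow, ← map_mul, ← map_smul, ← map_add]
    rw [Unitary.conjStarAlgAut_star_apply]
    rfl
  simp only [hentry, Finset.sum_add_distrib, hdesc]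
  have hsum : ∑ i ∈ S, h i ^ 4 =
      ∑ j ∈ Finset.univ.filter (fun j : Fin n => (j : ℕ) < r), h (τ j) ^ 4 := by
    rw [hSdef, Finset.sum_map]
    rfl
  rw [hsum]
  refine le_add_of_nonneg_right (sum_correction_nonneg _ h (fun i j => Complex.normSq_nonneg _)
    (fun i j => ?_) S hS)
  rw [← hφA.apply i j, RCLike.star_def, Complex.normSq_conj]
end
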